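/- Full gauge invariance of the linearized Weyl tensor: for every smooth symmetric field h_{μν} : ℝ^n → ℝ (n ≥ 3) and all smooth parameters ξ_μ : ℝ^n → ℝ and φ : ℝ^n → ℝ, setting h^{ξ,φ}_{μν} = h_{μν} + ∂_μξ_ν + ∂_νξ_μ + 2φη_{μν}, one has 𝒲_{αβγδ}[h^{ξ,φ}] = 𝒲_{αβγδ}[h] for all indices and all points. -/

import Mathlib

noncomputable section

open MeasureTheory

/-- Minkowski metric `diag(-1,1,…,1)` on `Fin n`. -/
def eta (n : ℕ) (μ ν : Fin n) : ℝ :=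
  if μ = ν then (if (μ : ℕ) = 0 then -1 else 1) else 0

/-- Partial derivative in the coordinate direction `μ`. -/
def pd {n : ℕ} (μ : Fin n) (f : (Fin n → ℝ) → ℝ) : (Fin n → ℝ) → ℝ :=
  fun x => fderiv ℝ f x (Pi.single μ 1)

/-- A rank-2 covariant field on `ℝ^n`. -/
abbrev TensorField (n : ℕ) := Fin n → Fin n → (Fin n → ℝ) → ℝ

/-- Linearized Riemann tensor
`ℛ_{αβγδ}[h] = −(1/2)(∂_α∂_γ h_{βδ} + ∂_β∂_δ h_{αγ} − ∂_α∂_δ h_{βγ} − ∂_β∂_γ h_{αδ})`. -/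
def Riem {n : ℕ} (h : TensorField n) (α β γ δ : Fin n) : (Fin n → ℝ) → ℝ :=
  fun x => -(1/2) * (pd α (pd γ (h β δ)) x + pd β (pd δ (h α γ)) x
    - pd α (pd δ (h β γ)) x - pd β (pd γ (h α δ)) x)

/-- Linearized Ricci tensor
`ℛ_{μν}[h] = (1/2) η^{αλ}(∂_μ∂_α h_{λν} − ∂_λ∂_α h_{μν} − ∂_μ∂_ν h_{λα} + ∂_λ∂_ν h_{μα})`. -/
def Ricci {n : ℕ} (h : TensorField n) (μ ν : Fin n) : (Fin n → ℝ) → ℝ :=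
  fun x => (1/2) * ∑ α, ∑ l, eta n α l *
    (pd μ (pd α (h l ν)) x - pd l (pd α (h μ ν)) x
      - pd μ (pd ν (h l α)) x + pd l (pd ν (h μ α)) x)

/-- Linearized scalar curvature `ℛ[h] = η^{αλ}η^{μν}(∂_λ∂_ν h_{μα} − ∂_α∂_λ h_{μν})`. -/
def Scal {n : ℕ} (h : TensorField n) : (Fin n → ℝ) → ℝ :=
  fun x => ∑ α, ∑ l, ∑ μ, ∑ ν, eta n α l * eta n μ ν *
    (pd l (pd ν (h μ α)) x - pd α (pd l (h μ ν)) x)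

/-- Linearized Schouten-type tensor
`𝒦_{μν}[h] = (1/(n−2))(ℛ_{μν}[h] − η_{μν}ℛ[h]/(2(n−1)))`. -/
def Kt {n : ℕ} (h : TensorField n) (μ ν : Fin n) : (Fin n → ℝ) → ℝ :=
  fun x => (1 / ((n : ℝ) - 2)) *
    (Ricci h μ ν x - eta n μ ν * Scal h x / (2 * ((n : ℝ) - 1)))

/-- Linearized Weyl tensor
`𝒲_{αβγδ}[h] = ℛ_{αβγδ}[h] − η_{αγ}𝒦_{δβ}[h] + η_{αδ}𝒦_{γβ}[h] + η_{βγ}𝒦_{δα}[h] − η_{βδ}𝒦_{γα}[h]`. -/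
def Weyl {n : ℕ} (h : TensorField n) (α β γ δ : Fin n) : (Fin n → ℝ) → ℝ :=
  fun x => Riem h α β γ δ x - eta n α γ * Kt h δ β x + eta n α δ * Kt h γ β x
    + eta n β γ * Kt h δ α x - eta n β δ * Kt h γ α x

/-- Linearized Cotton tensor `𝒞_{αβμ}[h] = ∂_μ𝒦_{βα}[h] − ∂_β𝒦_{μα}[h]`. -/
def Cotton {n : ℕ} (h : TensorField n) (α β μ : Fin n) : (Fin n → ℝ) → ℝ :=
  fun x => pd μ (Kt h β α) x - pd β (Kt h μ α) x

/-- Cotton tensor with all indices raised: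
`𝒞^{αβρ}[h] = η^{αα'}η^{ββ'}η^{ρρ'}𝒞_{α'β'ρ'}[h]`. -/
def CottonUp {n : ℕ} (h : TensorField n) (α β ρ : Fin n) : (Fin n → ℝ) → ℝ :=
  fun x => ∑ α', ∑ β', ∑ ρ', eta n α α' * eta n β β' * eta n ρ ρ' * Cotton h α' β' ρ' x

/-- Linearized Bach tensor `ℬ^{αβ}[h] = −2∂_ρ𝒞^{αβρ}[h]`. -/
def Bach {n : ℕ} (h : TensorField n) (α β : Fin n) : (Fin n → ℝ) → ℝ :=
  fun x => -2 * ∑ ρ, pd ρ (CottonUp h α β ρ) x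

section PartialDerivatives

variable {n : ℕ} {f g : (Fin n → ℝ) → ℝ}

lemma contDiff_pd (hf : ContDiff ℝ (⊤ : ℕ∞) f) (μ : Fin n) : ContDiff ℝ (⊤ : ℕ∞) (pd μ f) :=
  (hf.fderiv_right (by simp)).clm_apply contDiff_const

lemma pd_add (hf : ContDiff ℝ (⊤ : ℕ∞) f) (hg : ContDiff ℝ (⊤ : ℕ∞) g) (μ : Fin n) :
    pd μ (fun x => f x + g x) = fun x => pd μ f x + pd μ g x := by
  funext x
  unfold pd
  rw [fderiv_fun_add (hf.differentiable (by simp) x) (hg.differentiable (by simp) x)]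
  rfl

lemma pd_mul_const (hf : ContDiff ℝ (⊤ : ℕ∞) f) (c : ℝ) (μ : Fin n) :
    pd μ (fun x => f x * c) = fun x => pd μ f x * c := by
  funext x
  unfold pd
  rw [fderiv_mul_const (hf.differentiable (by simp) x)]
  simp [mul_comm]

lemma pd_comm (hf : ContDiff ℝ (⊤ : ℕ∞) f) (μ ν : Fin n) : pd μ (pd ν f) = pd ν (pd μ f) := by
  have hd : Differentiable ℝ (fderiv ℝ f) :=
    (hf.fderiv_right (m := (⊤ : ℕ∞)) (by simp)).differentiable (by simp)
  have key : ∀ (a b : Fin n) x, pd a (pd b f) x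
      = fderiv ℝ (fderiv ℝ f) x (Pi.single a 1) (Pi.single b 1) := by
    intro a b x
    unfold pd
    rw [fderiv_clm_apply (hd x) (differentiableAt_const _)]
    simp
  funext x
  rw [key, key]
  exact (hf.contDiffAt.isSymmSndFDerivAt
    (by simpa using WithTop.coe_le_coe.2 (le_top (a := (2 : ℕ∞))))) _ _

end PartialDerivatives

section Metric

variable {n : ℕ}

lemma eta_comm (μ ν : Fin n) : eta n μ ν = eta n ν μ := by
  unfold eta
  by_cases hμν : μ = ν
  · rw [hμν]
  · rw [if_neg hμν, if_neg (Ne.symm hμν)]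

lemma eta_self_mul_self (μ : Fin n) : eta n μ μ * eta n μ μ = 1 := by
  rw [eta, if_pos rfl]
  split_ifs <;> norm_num

lemma sum_eta_mul (μ : Fin n) (f : Fin n → ℝ) :
    ∑ ν, eta n μ ν * f ν = eta n μ μ * f μ := by
  refine Finset.sum_eq_single μ (fun ν _ hν => ?_) (by simp)
  simp [eta, Ne.symm hν]

lemma sum_eta_self_mul_eta_mul (μ : Fin n) (f : Fin n → ℝ) :
    ∑ ν, eta n ν ν * (eta n μ ν * f ν) = f μ := by
  simp_rw [mul_left_comm (eta n _ _) (eta n μ _)]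
  rw [sum_eta_mul, ← mul_assoc, eta_self_mul_self, one_mul]

end Metric

section GaugeTransformation

variable {n : ℕ}

/-- The flat wave operator. -/
def box (f : (Fin n → ℝ) → ℝ) (x : Fin n → ℝ) : ℝ := ∑ α, eta n α α * pd α (pd α f) x

/-- The gauge transform `h_{μν} + ∂_μξ_ν + ∂_νξ_μ + 2φη_{μν}` of `h`. -/
abbrev gaugeTransform (h : TensorField n) (ξ : Fin n → (Fin n → ℝ) → ℝ)
    (φ : (Fin n → ℝ) → ℝ) : TensorField n :=
  fun μ ν x => h μ ν x + pd μ (ξ ν) x + pd ν (ξ μ) x + 2 * φ x * eta n μ ν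

variable {h : TensorField n} {ξ : Fin n → (Fin n → ℝ) → ℝ} {φ : (Fin n → ℝ) → ℝ}

lemma pd_pd_gaugeTransform (hh : ∀ μ ν, ContDiff ℝ (⊤ : ℕ∞) (h μ ν))
    (hξ : ∀ μ, ContDiff ℝ (⊤ : ℕ∞) (ξ μ)) (hφ : ContDiff ℝ (⊤ : ℕ∞) φ)
    (α β μ ν : Fin n) (x : Fin n → ℝ) :
    pd α (pd β (gaugeTransform h ξ φ μ ν)) x
      = pd α (pd β (h μ ν)) x + pd α (pd β (pd μ (ξ ν))) x + pd α (pd β (pd ν (ξ μ))) x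
        + pd α (pd β φ) x * (2 * eta n μ ν) := by
  have e : gaugeTransform h ξ φ μ ν
      = fun x => h μ ν x + pd μ (ξ ν) x + pd ν (ξ μ) x + φ x * (2 * eta n μ ν) := by
    funext x
    simp only [gaugeTransform]
    ring
  have h1 := hh μ ν
  have h2 := contDiff_pd (hξ ν) μ
  have h3 := contDiff_pd (hξ μ) ν
  have h4 : ContDiff ℝ (⊤ : ℕ∞) fun x => φ x * (2 * eta n μ ν) := hφ.mul contDiff_const
  have k4 : ContDiff ℝ (⊤ : ℕ∞) fun x => pd β φ x * (2 * eta n μ ν) :=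
    (contDiff_pd hφ β).mul contDiff_const
  have k1 := contDiff_pd h1 β
  have k2 := contDiff_pd h2 β
  have k3 := contDiff_pd h3 β
  rw [e, pd_add ((h1.add h2).add h3) h4, pd_add (h1.add h2) h3, pd_add h1 h2, pd_mul_const hφ,
    pd_add ((k1.add k2).add k3) k4, pd_add (k1.add k2) k3, pd_add k1 k2,
    pd_mul_const (contDiff_pd hφ β)]

lemma Riem_gaugeTransform (hh : ∀ μ ν, ContDiff ℝ (⊤ : ℕ∞) (h μ ν))
    (hξ : ∀ μ, ContDiff ℝ (⊤ : ℕ∞) (ξ μ)) (hφ : ContDiff ℝ (⊤ : ℕ∞) φ)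
    (α β γ δ : Fin n) (x : Fin n → ℝ) :
    Riem (gaugeTransform h ξ φ) α β γ δ x = Riem h α β γ δ x
      - (eta n β δ * pd α (pd γ φ) x + eta n α γ * pd β (pd δ φ) x
        - eta n β γ * pd α (pd δ φ) x - eta n α δ * pd β (pd γ φ) x) := by
  unfold Riem
  simp only [pd_pd_gaugeTransform hh hξ hφ]
  rw [pd_comm (hξ δ) γ β, pd_comm (contDiff_pd (hξ δ) γ) α β, pd_comm (hξ δ) α γ,
    pd_comm (hξ β) γ δ, pd_comm (hξ γ) δ α, pd_comm (contDiff_pd (hξ γ) δ) β α,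
    pd_comm (hξ γ) β δ, pd_comm (hξ α) δ γ]
  ring

lemma Ricci_gaugeTransform (hh : ∀ μ ν, ContDiff ℝ (⊤ : ℕ∞) (h μ ν))
    (hξ : ∀ μ, ContDiff ℝ (⊤ : ℕ∞) (ξ μ)) (hφ : ContDiff ℝ (⊤ : ℕ∞) φ)
    (μ ν : Fin n) (x : Fin n → ℝ) :
    Ricci (gaugeTransform h ξ φ) μ ν x
      = Ricci h μ ν x - ((n : ℝ) - 2) * pd μ (pd ν φ) x - eta n μ ν * box φ x := by
  unfold Ricci
  simp only [sum_eta_mul]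
  have key : ∀ α, eta n α α * (pd μ (pd α (gaugeTransform h ξ φ α ν)) x
        - pd α (pd α (gaugeTransform h ξ φ μ ν)) x
        - pd μ (pd ν (gaugeTransform h ξ φ α α)) x
        + pd α (pd ν (gaugeTransform h ξ φ μ α)) x)
      = eta n α α * (pd μ (pd α (h α ν)) x - pd α (pd α (h μ ν)) x
          - pd μ (pd ν (h α α)) x + pd α (pd ν (h μ α)) x)
        + 2 * (eta n α α * (eta n ν α * pd μ (pd α φ) x))
        + 2 * (eta n α α * (eta n μ α * pd α (pd ν φ) x))
        - 2 * eta n μ ν * (eta n α α * pd α (pd α φ) x)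
        - 2 * pd μ (pd ν φ) x := by
    intro α
    simp only [pd_pd_gaugeTransform hh hξ hφ]
    have e1 : pd μ (pd α (pd α (ξ ν))) = pd α (pd α (pd μ (ξ ν))) := by
      rw [pd_comm (contDiff_pd (hξ ν) α) μ α, pd_comm (hξ ν) μ α]
    have e2 : pd μ (pd α (pd ν (ξ α))) = pd μ (pd ν (pd α (ξ α))) := by
      rw [pd_comm (hξ α) α ν]
    have e3 : pd α (pd ν (pd α (ξ μ))) = pd α (pd α (pd ν (ξ μ))) := by
      rw [pd_comm (hξ μ) ν α]
    have e4 : pd α (pd ν (pd μ (ξ α))) = pd μ (pd ν (pd α (ξ α))) := by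
      rw [pd_comm (hξ α) ν μ, pd_comm (contDiff_pd (hξ α) ν) α μ, pd_comm (hξ α) α ν]
    rw [e1, e2, e3, e4, eta_comm ν α]
    linear_combination (-2 * pd μ (pd ν φ) x) * eta_self_mul_self α
  simp only [key, Finset.sum_add_distrib, Finset.sum_sub_distrib, ← Finset.mul_sum,
    sum_eta_self_mul_eta_mul, Finset.sum_const, Finset.card_univ, Fintype.card_fin,
    nsmul_eq_mul, box]
  ring

lemma Scal_gaugeTransform (hh : ∀ μ ν, ContDiff ℝ (⊤ : ℕ∞) (h μ ν))
    (hξ : ∀ μ, ContDiff ℝ (⊤ : ℕ∞) (ξ μ)) (hφ : ContDiff ℝ (⊤ : ℕ∞) φ) (x : Fin n → ℝ) :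
    Scal (gaugeTransform h ξ φ) x = Scal h x - 2 * ((n : ℝ) - 1) * box φ x := by
  unfold Scal
  simp only [mul_assoc, ← Finset.mul_sum, sum_eta_mul]
  have key : ∀ α μ, eta n μ μ * (pd α (pd μ (gaugeTransform h ξ φ μ α)) x
        - pd α (pd α (gaugeTransform h ξ φ μ μ)) x)
      = eta n μ μ * (pd α (pd μ (h μ α)) x - pd α (pd α (h μ μ)) x)
        + eta n μ μ * pd μ (pd μ (pd α (ξ α))) x
        - eta n μ μ * pd α (pd α (pd μ (ξ μ))) x
        + 2 * (eta n μ μ * (eta n α μ * pd α (pd μ φ) x))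
        - 2 * pd α (pd α φ) x := by
    intro α μ
    simp only [pd_pd_gaugeTransform hh hξ hφ]
    have e1 : pd α (pd μ (pd μ (ξ α))) = pd μ (pd μ (pd α (ξ α))) := by
      rw [pd_comm (contDiff_pd (hξ α) μ) α μ, pd_comm (hξ α) α μ]
    have e2 : pd α (pd μ (pd α (ξ μ))) = pd α (pd α (pd μ (ξ μ))) := by
      rw [pd_comm (hξ μ) μ α]
    rw [e1, e2, eta_comm μ α]
    linear_combination (-2 * pd α (pd α φ) x) * eta_self_mul_self μ
  have hcomm : ∑ α, eta n α α * ∑ μ, eta n μ μ * pd μ (pd μ (pd α (ξ α))) x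
      = ∑ α, eta n α α * ∑ μ, eta n μ μ * pd α (pd α (pd μ (ξ μ))) x := by
    simp only [Finset.mul_sum]
    rw [Finset.sum_comm]
    exact Finset.sum_congr rfl fun α _ => Finset.sum_congr rfl fun μ _ => mul_left_comm _ _ _
  simp only [key, Finset.sum_add_distrib, Finset.sum_sub_distrib, ← Finset.mul_sum,
    sum_eta_self_mul_eta_mul, Finset.sum_const, Finset.card_univ, Fintype.card_fin,
    nsmul_eq_mul, mul_add, mul_sub, hcomm, mul_left_comm (eta n _ _) (2 : ℝ),
    mul_left_comm (eta n _ _) (n : ℝ), box]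
  ring

lemma Kt_gaugeTransform (hn : 3 ≤ n) (hh : ∀ μ ν, ContDiff ℝ (⊤ : ℕ∞) (h μ ν))
    (hξ : ∀ μ, ContDiff ℝ (⊤ : ℕ∞) (ξ μ)) (hφ : ContDiff ℝ (⊤ : ℕ∞) φ)
    (μ ν : Fin n) (x : Fin n → ℝ) :
    Kt (gaugeTransform h ξ φ) μ ν x = Kt h μ ν x - pd μ (pd ν φ) x := by
  have hn' : (3 : ℝ) ≤ n := by exact_mod_cast hn
  have h1 : (n : ℝ) - 1 ≠ 0 := by linarith
  have h2 : (n : ℝ) - 2 ≠ 0 := by linarith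
  unfold Kt
  rw [Ricci_gaugeTransform hh hξ hφ, Scal_gaugeTransform hh hξ hφ]
  field_simp
  ring

end GaugeTransformation

/-- full gauge invariance of the linearized Weyl tensor under
`h^{ξ,φ}_{μν} = h_{μν} + ∂_μξ_ν + ∂_νξ_μ + 2φη_{μν}`. -/
theorem weyl_tensor_gauge_invariant {n : ℕ} (hn : 3 ≤ n)
    (h : TensorField n) (hsmooth : ∀ μ ν, ContDiff ℝ (⊤ : ℕ∞) (h μ ν))
    (hsym : ∀ μ ν, h μ ν = h ν μ)
    (ξ : Fin n → (Fin n → ℝ) → ℝ) (hξ : ∀ μ, ContDiff ℝ (⊤ : ℕ∞) (ξ μ))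
    (φ : (Fin n → ℝ) → ℝ) (hφ : ContDiff ℝ (⊤ : ℕ∞) φ) :
    ∀ (α β γ δ : Fin n) (x : Fin n → ℝ),
      Weyl (fun μ ν x => h μ ν x + pd μ (ξ ν) x + pd ν (ξ μ) x + 2 * φ x * eta n μ ν)
          α β γ δ x
        = Weyl h α β γ δ x := by
  intro α β γ δ x
  change Weyl (gaugeTransform h ξ φ) α β γ δ x = Weyl h α β γ δ x
  unfold Weyl
  rw [Riem_gaugeTransform hsmooth hξ hφ]
  simp only [Kt_gaugeTransform hn hsmooth hξ hφ]
  rw [pd_comm hφ δ β, pd_comm hφ γ β, pd_comm hφ δ α, pd_comm hφ γ α]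
  ring
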